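/- arXiv:1710.05996 — 2 statements merged into one kernel-verified Lean document; each statement's English description precedes it below -/
import Mathlib

section
/- Let $n \ge 2$ and $k \ge 1$. Then the depth of $S/I(P_n^k)$ over $S = K[x_1,\dots,x_n]$ equals $\lceil n/(2k+1) \rceil$, where $I(P_n^k)$ is the edge ideal of the $k$-th power of a path on $n$ vertices. -/
open MvPolynomial

/-- The edge ideal of the `k`-th power of the path on `n` vertices in
`S = K[x_1,…,x_n]` (the variable `X t` for `t : Fin n` is `x_{t+1}` in 1-based labels):
generated by the `x_i x_j` with `0 < j - i ≤ k`. -/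
noncomputable def pathIdeal (K : Type*) [Field K] (n k : ℕ) :
    Ideal (MvPolynomial (Fin n) K) :=
  Ideal.span {m | ∃ i j : Fin n, (i : ℕ) < j ∧ (j : ℕ) - i ≤ k ∧ m = X i * X j}

/-- The edge ideal of the `k`-th power of the cycle on `n` vertices in `K[x_1,…,x_n]`. -/
noncomputable def cycleIdeal (K : Type*) [Field K] (n k : ℕ) :
    Ideal (MvPolynomial (Fin n) K) :=
  Ideal.span {m | ∃ i j : Fin n, (i : ℕ) < j ∧ ((j : ℕ) - i ≤ k ∨ n - k ≤ (j : ℕ) - i) ∧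
    m = X i * X j}

/-- The edge ideal, regarded in `K[x_1,…,x_n]`, of the `k`-th power of the path on the
consecutive vertices with 1-based labels `a,…,b`. -/
noncomputable def pathIdealOn (K : Type*) [Field K] (n k a b : ℕ) :
    Ideal (MvPolynomial (Fin n) K) :=
  Ideal.span {m | ∃ i j : Fin n, a ≤ (i : ℕ) + 1 ∧ (j : ℕ) + 1 ≤ b ∧ (i : ℕ) < j ∧
    (j : ℕ) - i ≤ k ∧ m = X i * X j}

/-- The monomial prime ideal `(x_a, x_{a+1}, …, x_b)` of `K[x_1,…,x_n]` (1-based labels). -/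
noncomputable def varSpan (K : Type*) [Field K] (n a b : ℕ) :
    Ideal (MvPolynomial (Fin n) K) :=
  Ideal.span {m | ∃ t : Fin n, a ≤ (t : ℕ) + 1 ∧ (t : ℕ) + 1 ≤ b ∧ m = X t}

/-- The depth of `S/I` with respect to the maximal graded ideal `(x_1,…,x_n)`:
the supremum of lengths of (weakly) regular sequences on `S/I` from `(x_1,…,x_n)`. -/
noncomputable def pdepth {K : Type*} [Field K] {n : ℕ} (I : Ideal (MvPolynomial (Fin n) K)) :
    ℕ∞ :=
  sSup {d : ℕ∞ | ∃ rs : List (MvPolynomial (Fin n) K),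
    (∀ r ∈ rs, r ∈ Ideal.span (Set.range (X (R := K) (σ := Fin n)))) ∧
    RingTheory.Sequence.IsWeaklyRegular (MvPolynomial (Fin n) K ⧸ I) rs ∧
    (rs.length : ℕ∞) = d}

/-- The set of exponent vectors of monomials belonging to a (monomial) ideal `I`. -/
def monSet {K : Type*} [Field K] {n : ℕ} (I : Ideal (MvPolynomial (Fin n) K)) :
    Set (Fin n → ℕ) :=
  {a | (∏ i, X i ^ a i : MvPolynomial (Fin n) K) ∈ I}

/-- The set of exponent vectors of the monomials of the Stanley space `x^a K[W]`. -/
def stanleyInterval {n : ℕ} (a : Fin n → ℕ) (W : Finset (Fin n)) : Set (Fin n → ℕ) :=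
  {c | (∀ i, a i ≤ c i) ∧ ∀ i ∉ W, c i = a i}

/-- The Stanley depth of `J/I` for monomial ideals `I ⊆ J` of `K[x_1,…,x_n]`: the largest
`d` such that the monomials of `J \ I` can be partitioned into finitely many Stanley spaces
`x^a K[W]` with `|W| ≥ d` (by Herzog–Vladoiu–Zheng this agrees with the Stanley depth of the
`ℤⁿ`-graded module `J/I` defined via Stanley decompositions). -/
noncomputable def sdepthQuot {K : Type*} [Field K] {n : ℕ}
    (I J : Ideal (MvPolynomial (Fin n) K)) : ℕ :=
  sSup {d : ℕ | ∃ P : Finset ((Fin n → ℕ) × Finset (Fin n)),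
    (∀ p ∈ P, d ≤ p.2.card) ∧
    ∀ c : Fin n → ℕ, (c ∈ monSet J ∧ c ∉ monSet I) ↔
      ∃! p, p ∈ P ∧ c ∈ stanleyInterval p.1 p.2}


open Pointwise in
lemma key_assoc {R : Type*} [CommRing R] [IsNoetherianRing R] (m : Ideal R) [m.IsPrime]
    {M : Type*} [AddCommGroup M] [Module R M] [Module.Finite R M] {x : R} (hxm : x ∈ m)
    (hx : IsSMulRegular M x) {p : Ideal R} (hp : p ∈ associatedPrimes R M) (hpm : p ≤ m) :
    ∃ q ∈ associatedPrimes R (QuotSMulTop x M), q ≤ m ∧ p ≤ q ∧ x ∈ q := by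
  classical
  obtain ⟨hpp, y, hy⟩ := isAssociatedPrime_iff.mp (AssociatedPrimes.mem_iff.mp hp)
  have hyp : ∀ a, a ∈ p ↔ a • y = 0 := by
    intro a
    rw [hy, Submodule.mem_colon_singleton, Submodule.mem_bot]
  let N : Submodule R M := Submodule.torsionBySet R M p
  have hN : ∀ n, n ∈ N ↔ ∀ a ∈ p, a • n = 0 := by
    intro n
    simp [N, Submodule.mem_torsionBySet_iff]
  have hyN : y ∈ N := (hN y).2 fun a ha => (hyp a).1 ha
  have main : ∃ n ∈ N, ∀ s, s • n ∈ (x • ⊤ : Submodule R M) → s ∈ m := by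
    by_contra! hcon
    have h1 : ∃ s, s ∉ m ∧ ∀ n ∈ N, s • n ∈ (x • ⊤ : Submodule R M) := by
      obtain ⟨T, hT⟩ : N.FG := IsNoetherian.noetherian N
      have hTN : ∀ t : T, (t : M) ∈ N := fun t => hT ▸ Submodule.subset_span t.2
      choose f hf hf' using fun t : T => hcon t (hTN t)
      refine ⟨∏ t : T, f t, fun h => ?_, ?_⟩
      · obtain ⟨t, -, ht⟩ := (Ideal.IsPrime.prod_mem_iff (p := m)).1 h
        exact hf' t ht
      · intro n hn
        rw [← hT] at hn
        induction hn using Submodule.span_induction with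
        | mem t ht =>
          rw [← Finset.mul_prod_erase _ _ (Finset.mem_univ (⟨t, ht⟩ : T)), mul_comm, mul_smul]
          exact Submodule.smul_mem _ _ (hf ⟨t, ht⟩)
        | zero => simp
        | add a b _ _ ha hb => rw [smul_add]; exact add_mem ha hb
        | smul c a _ ha => rw [smul_comm]; exact Submodule.smul_mem _ _ ha
    obtain ⟨s, hs, hsN⟩ := h1
    obtain ⟨P, hP, -, hPc, hP0⟩ :=
      LinearMap.exists_monic_and_natDegree_eq_and_coeff_mem_pow_and_aeval_eq_zero
      R (s • (1 : Module.End R N)) (Ideal.span {x}) (by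
        rintro _ ⟨n, rfl⟩
        have h2 := hsN n n.2
        obtain ⟨n1, -, h3⟩ := (Submodule.mem_smul_pointwise_iff_exists _ _ _).1 h2
        have h4 : n1 ∈ N := by
          rw [hN]
          intro a ha
          apply hx
          simp only [smul_zero]
          rw [smul_comm, h3, smul_comm, (hN _).1 n.2 a ha, smul_zero]
        have : (s • (1 : Module.End R N)) n = x • (⟨n1, h4⟩ : N) := by
          ext
          simpa using h3.symm
        rw [this]
        exact Submodule.smul_mem_smul (Ideal.mem_span_singleton_self x) trivial)
    have h5 : P.eval s ∈ p := by
      rw [hyp]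
      have := LinearMap.congr_fun hP0 ⟨y, hyN⟩
      have h6 : s • (1 : Module.End R N) = algebraMap R _ s := by
        rw [Algebra.algebraMap_eq_smul_one]
      rw [h6, Polynomial.aeval_algebraMap_apply] at this
      simpa [Module.algebraMap_end_apply] using congrArg Subtype.val this
    have h7 : P.eval s - s ^ P.natDegree ∈ m := by
      rw [Polynomial.eval_eq_sum_range, Finset.sum_range_succ, hP.coeff_natDegree, one_mul,
        add_sub_cancel_right]
      refine Ideal.sum_mem _ fun i hi => Ideal.mul_mem_right _ _ ?_
      have := Ideal.pow_le_self (I := Ideal.span {x}) (n := P.natDegree - i)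
        (by have := Finset.mem_range.1 hi; omega) (hPc i)
      exact (Ideal.span_singleton_le_iff_mem m).2 hxm this
    have h8 : s ^ P.natDegree ∈ m := by
      have := m.sub_mem (hpm h5) h7
      simpa using this
    exact hs (Ideal.IsPrime.mem_of_pow_mem ‹_› _ h8)
  obtain ⟨n, hn, hnm⟩ := main
  let z : QuotSMulTop x M := Submodule.Quotient.mk n
  have hz : ∀ a : R, a • z = 0 ↔ a • n ∈ (x • ⊤ : Submodule R M) := by
    intro a
    rw [← Submodule.Quotient.mk_smul]
    exact Submodule.Quotient.mk_eq_zero _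
  let J : Ideal R := (⊥ : Submodule R (QuotSMulTop x M)).colon {z}
  have hJ : ∀ a, a ∈ J ↔ a • n ∈ (x • ⊤ : Submodule R M) := by
    intro a
    rw [← hz, Submodule.mem_colon_singleton, Submodule.mem_bot]
  have hJm : J ≤ m := fun a ha => hnm a ((hJ a).1 ha)
  obtain ⟨q, hq, hqm⟩ := Ideal.exists_minimalPrimes_le hJm
  refine ⟨q, ?_, hqm, ?_, ?_⟩
  · rw [AssociatedPrimes.mem_iff, isAssociatedPrime_iff]
    exact ⟨hq.1.1, Submodule.exists_eq_colon_of_mem_minimalPrimes hq⟩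
  · intro a ha
    refine hq.1.2 ((hJ a).2 ?_)
    rw [(hN n).1 hn a ha]
    exact zero_mem _
  · exact hq.1.2 ((hJ x).2 (Submodule.smul_mem_pointwise_smul _ _ _ trivial))

lemma length_le_dim {R : Type*} [CommRing R] [IsNoetherianRing R] (m : Ideal R) [m.IsPrime]
    (rs : List R) : ∀ (M : Type*) [AddCommGroup M] [Module R M] [Module.Finite R M],
    (∀ r ∈ rs, r ∈ m) → RingTheory.Sequence.IsWeaklyRegular M rs →
    ∀ p ∈ associatedPrimes R M, p ≤ m → (rs.length : WithBot ℕ∞) ≤ ringKrullDim (R ⧸ p) := by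
  induction rs with
  | nil =>
    intro M _ _ _ _ _ p hp _
    have : p.IsPrime := hp.1
    simpa using ringKrullDim_nonneg_of_nontrivial
  | cons x rs ih =>
    intro M _ _ _ hm hreg p hp hpm
    have hpP : p.IsPrime := hp.1
    rw [RingTheory.Sequence.isWeaklyRegular_cons_iff] at hreg
    obtain ⟨q, hq, hqm, hpq, hxq⟩ := key_assoc m (hm x (by simp)) hreg.1 hp hpm
    have h1 := ih (QuotSMulTop x M) (fun r hr => hm r (by simp [hr])) hreg.2 q hq hqm
    have hxp : x ∉ p := by
      intro hxp
      obtain ⟨hpp, y, hy⟩ := isAssociatedPrime_iff.mp (AssociatedPrimes.mem_iff.mp hp)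
      have h2 : x • y = 0 := by
        rw [hy, Submodule.mem_colon_singleton, Submodule.mem_bot] at hxp
        exact hxp
      have h3 : y = 0 := hreg.1 (by simpa using h2)
      apply hpp.ne_top
      rw [hy, h3, Ideal.eq_top_iff_one, Submodule.mem_colon_singleton]
      simp
    have h2 := ringKrullDim_succ_le_of_surjective (Ideal.Quotient.factor hpq)
      (Ideal.Quotient.factor_surjective hpq) (r := Ideal.Quotient.mk p x)
      (mem_nonZeroDivisors_of_ne_zero (by rwa [Ne, Ideal.Quotient.eq_zero_iff_mem]))
      (by rw [Ideal.Quotient.factor_mk, Ideal.Quotient.eq_zero_iff_mem]; exact hxq)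
    refine le_trans ?_ h2
    simp only [List.length_cons, Nat.cast_add, Nat.cast_one]
    gcongr


universe u

/-- existence of a regular sequence of length `d` -/
def HasReg {R : Type u} [CommRing R] (m J : Ideal R) (d : ℕ) : Prop :=
  ∃ rs : List R, rs.length = d ∧ (∀ r ∈ rs, r ∈ m) ∧ RingTheory.Sequence.IsRegular (R ⧸ J) rs

lemma smul_top_lt_aux {R : Type u} [CommRing R] {m J : Ideal R} (hm : m ≠ ⊤) (hJ : J ≤ m) :
    m • (⊤ : Submodule R (R ⧸ J)) < ⊤ := by
  rw [lt_top_iff_ne_top]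
  intro h
  apply hm
  have h1 : m • (⊤ : Submodule R (R ⧸ J)) ≤ Submodule.map (Submodule.mkQ J) m := by
    rw [Submodule.smul_le]
    rintro r hr z -
    obtain ⟨z, rfl⟩ := Submodule.mkQ_surjective J z
    exact ⟨r * z, m.mul_mem_right _ hr, by simp [← smul_eq_mul]⟩
  rw [h, top_le_iff] at h1
  rw [Ideal.eq_top_iff_one]
  have h2 : Submodule.mkQ J 1 ∈ Submodule.map (Submodule.mkQ J) m := by rw [h1]; trivial
  obtain ⟨a, ha, hab⟩ := h2
  have h3 : a - 1 ∈ J := (Submodule.Quotient.eq J).1 hab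
  have := m.sub_mem ha (hJ h3)
  simpa using this

open CategoryTheory Abelian in
lemma HasReg.of_ses {R : Type u} [CommRing R] [IsNoetherianRing R] {m J A B : Ideal R} {x : R}
    {d : ℕ} (hm : m ≠ ⊤) (hJm : J ≤ m) (hAm : A ≤ m) (hBm : B ≤ m)
    (hA : ∀ g, g ∈ A ↔ x * g ∈ J) (hB : B = J ⊔ Ideal.span {x})
    (h1 : HasReg m A d) (h2 : HasReg m B d) : HasReg m J d := by
  have e1 := ((ModuleCat.exists_isRegular_tfae m d (ModuleCat.of R (R ⧸ A))
    (smul_top_lt_aux hm hAm)).out 3 1).1 h1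
  have e2 := ((ModuleCat.exists_isRegular_tfae m d (ModuleCat.of R (R ⧸ B))
    (smul_top_lt_aux hm hBm)).out 3 1).1 h2
  refine ((ModuleCat.exists_isRegular_tfae m d (ModuleCat.of R (R ⧸ J))
    (smul_top_lt_aux hm hJm)).out 1 3).1 ?_
  have hAJ : A ≤ Submodule.comap (LinearMap.mulLeft R x) J := fun g hg => (hA g).1 hg
  have hJB : J ≤ Submodule.comap (LinearMap.id) B := by rw [hB]; exact le_sup_left
  let f : (R ⧸ A) →ₗ[R] (R ⧸ J) := Submodule.mapQ A J (LinearMap.mulLeft R x) hAJ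
  let g : (R ⧸ J) →ₗ[R] (R ⧸ B) := Submodule.mapQ J B LinearMap.id hJB
  have hf : Function.Injective f := by
    rw [← LinearMap.ker_eq_bot, LinearMap.ker_eq_bot']
    intro z hz
    obtain ⟨z, rfl⟩ := Submodule.mkQ_surjective A z
    have h3 : x * z ∈ J := (Submodule.Quotient.mk_eq_zero J).1 hz
    exact (Submodule.Quotient.mk_eq_zero A).2 ((hA z).2 h3)
  have hg : Function.Surjective g := by
    intro z
    obtain ⟨z, rfl⟩ := Submodule.mkQ_surjective B z
    exact ⟨Submodule.mkQ J z, rfl⟩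
  have hfg : Function.Exact f g := by
    intro z
    obtain ⟨z, rfl⟩ := Submodule.mkQ_surjective J z
    constructor
    · intro hz
      have h3 : z ∈ B := (Submodule.Quotient.mk_eq_zero B).1 hz
      rw [hB, Submodule.mem_sup] at h3
      obtain ⟨a, ha, b, hb, rfl⟩ := h3
      obtain ⟨c, rfl⟩ := Ideal.mem_span_singleton'.1 hb
      refine ⟨Submodule.mkQ A c, ?_⟩
      refine (Submodule.Quotient.eq J).2 ?_
      have : LinearMap.mulLeft R x c - (a + c * x) = -a := by
        simp only [LinearMap.mulLeft_apply]; ring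
      rw [this]
      exact J.neg_mem ha
    · rintro ⟨w, hw⟩
      obtain ⟨w, rfl⟩ := Submodule.mkQ_surjective A w
      rw [← hw]
      refine (Submodule.Quotient.mk_eq_zero B).2 ?_
      rw [hB]
      exact Ideal.mem_sup_right (Ideal.mem_span_singleton.2 ⟨w, rfl⟩)
  let S : ShortComplex (ModuleCat.{u} R) :=
    ShortComplex.mk (ModuleCat.ofHom f) (ModuleCat.ofHom g) (by
      rw [← ModuleCat.ofHom_comp, hfg.linearMap_comp_eq_zero]; rfl)
  have hS : S.ShortExact :=
    { exact := (ShortComplex.ShortExact.moduleCat_exact_iff_function_exact S).2 hfg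
      mono_f := (ModuleCat.mono_iff_injective _).2 hf
      epi_g := (ModuleCat.epi_iff_surjective _).2 hg }
  intro i hi
  have z1 := e1 i hi
  have z2 := e2 i hi
  refine subsingleton_of_forall_eq 0 fun y => ?_
  obtain ⟨w, hw⟩ := Ext.covariant_sequence_exact₂ _ hS (n := i) y (Subsingleton.elim (h := z2) _ _)
  rw [← hw, Subsingleton.elim (h := z1) w 0]
  simp

open Pointwise in
lemma HasReg.cons {R : Type u} [CommRing R] [IsNoetherianRing R] {m J B : Ideal R} {x : R}
    {d : ℕ} (hx : x ∈ m) (hA : ∀ g, x * g ∈ J → g ∈ J) (hB : B = J ⊔ Ideal.span {x})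
    (h2 : HasReg m B d) : HasReg m J (d + 1) := by
  obtain ⟨rs, hl, hr, hreg⟩ := h2
  refine ⟨x :: rs, by simp [hl], by simpa [hx] using hr, ?_⟩
  rw [RingTheory.Sequence.isRegular_cons_iff]
  constructor
  · rw [isSMulRegular_iff_right_eq_zero_of_smul]
    intro z hz
    obtain ⟨z, rfl⟩ := Submodule.mkQ_surjective J z
    exact (Submodule.Quotient.mk_eq_zero J).2 (hA z ((Submodule.Quotient.mk_eq_zero J).1 hz))
  · have h3 : (x • ⊤ : Submodule R (R ⧸ J)) = Submodule.map (Submodule.mkQ J) (Ideal.span {x}) := by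
      ext z
      rw [Submodule.mem_smul_pointwise_iff_exists]
      constructor
      · rintro ⟨w, -, rfl⟩
        obtain ⟨w, rfl⟩ := Submodule.mkQ_surjective J w
        exact ⟨x * w, Ideal.mem_span_singleton.2 ⟨w, rfl⟩, rfl⟩
      · rintro ⟨w, hw, rfl⟩
        obtain ⟨c, rfl⟩ := Ideal.mem_span_singleton.1 hw
        exact ⟨Submodule.mkQ J c, trivial, rfl⟩
    let e : QuotSMulTop x (R ⧸ J) ≃ₗ[R] (R ⧸ B) :=
      Submodule.quotEquivOfEq _ _ h3 ≪≫ₗ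
        Submodule.quotientQuotientEquivQuotientSup J (Ideal.span {x}) ≪≫ₗ
        Submodule.quotEquivOfEq _ _ hB.symm
    exact (e.isRegular_congr rs).2 hreg

/-- adjacency in the `k`-th power of the path -/
def padj {n : ℕ} (k : ℕ) (i j : Fin n) : Prop :=
  i ≠ j ∧ (i : ℕ) ≤ j + k ∧ (j : ℕ) ≤ i + k

lemma padj.symm {n k : ℕ} {i j : Fin n} (h : padj k i j) : padj k j i :=
  ⟨h.1.symm, h.2.2, h.2.1⟩

/-- exponents of monomials in the ideal obtained by killing the vertices in `U` -/
def Bad {n : ℕ} (k : ℕ) (U : Set (Fin n)) (s : Fin n →₀ ℕ) : Prop :=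
  (∃ u ∈ U, s u ≠ 0) ∨ ∃ i j, padj k i j ∧ s i ≠ 0 ∧ s j ≠ 0

lemma Bad.mono {n k : ℕ} {U : Set (Fin n)} {s t : Fin n →₀ ℕ} (h : s ≤ t) (hs : Bad k U s) :
    Bad k U t := by
  have h' : ∀ i, s i ≠ 0 → t i ≠ 0 := fun i hi => by have := h i; omega
  rcases hs with ⟨u, hu, hs⟩ | ⟨i, j, hij, hi, hj⟩
  · exact Or.inl ⟨u, hu, h' u hs⟩
  · exact Or.inr ⟨i, j, hij, h' i hi, h' j hj⟩

/-- the edge ideal plus the variables in `U` -/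
noncomputable def JI (K : Type u) [Field K] {n : ℕ} (k : ℕ) (U : Set (Fin n)) :
    Ideal (MvPolynomial (Fin n) K) :=
  Ideal.span ((fun s => monomial s (1 : K)) '' {s | Bad k U s})

lemma mem_JI {K : Type u} [Field K] {n k : ℕ} {U : Set (Fin n)} {f : MvPolynomial (Fin n) K} :
    f ∈ JI K k U ↔ ∀ s ∈ f.support, Bad k U s := by
  rw [JI, mem_ideal_span_monomial_image]
  refine forall₂_congr fun s _ => ⟨?_, fun h => ⟨s, h, le_rfl⟩⟩
  rintro ⟨t, ht, hts⟩
  exact Bad.mono hts ht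

lemma X_dvd_monomial' {K : Type u} [Field K] {n : ℕ} {s : Fin n →₀ ℕ} {v : Fin n} (h : s v ≠ 0) :
    (X v : MvPolynomial (Fin n) K) ∣ monomial s 1 := by
  rw [X_dvd_monomial]
  exact Or.inr h

lemma pathIdeal_eq (K : Type u) [Field K] (n k : ℕ) : pathIdeal K n k = JI K k ∅ := by
  apply le_antisymm
  · rw [pathIdeal, Ideal.span_le]
    rintro _ ⟨i, j, hij, hk, rfl⟩
    refine Ideal.subset_span ⟨Finsupp.single i 1 + Finsupp.single j 1, ?_, ?_⟩
    · right
      refine ⟨i, j, ⟨?_, by omega, by omega⟩, by simp, by simp⟩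
      rintro rfl
      omega
    · simp [X, monomial_mul]
  · rw [JI, Ideal.span_le]
    rintro _ ⟨s, hs, rfl⟩
    have main : ∀ i j : Fin n, (i : ℕ) < j → (j : ℕ) - i ≤ k → s i ≠ 0 → s j ≠ 0 →
        monomial s (1 : K) ∈ pathIdeal K n k := by
      intro i j hij hk hi hj
      have h1 : Finsupp.single i 1 + Finsupp.single j 1 ≤ s := by
        intro t
        have : i ≠ j := by rintro rfl; omega
        simp only [Finsupp.add_apply, Finsupp.single_apply]
        split_ifs <;> grind
      have h2 : (X i * X j : MvPolynomial (Fin n) K) ∣ monomial s 1 := by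
        have : (X i * X j : MvPolynomial (Fin n) K)
            = monomial (Finsupp.single i 1 + Finsupp.single j 1) 1 := by
          simp [X, monomial_mul]
        rw [this, monomial_dvd_monomial]
        simp [h1]
      exact Ideal.mem_of_dvd _ h2 (Ideal.subset_span ⟨i, j, hij, hk, rfl⟩)
    rcases hs with ⟨u, hu, _⟩ | ⟨i, j, ⟨hij, h1, h2⟩, hi, hj⟩
    · simp at hu
    · rcases lt_or_gt_of_ne hij with h | h
      · exact main i j h (by omega) hi hj
      · exact main j i h (by omega) hj hi

lemma JI_insert (K : Type u) [Field K] {n : ℕ} (k : ℕ) (U : Set (Fin n)) (v : Fin n) :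
    JI K k (insert v U) = JI K k U ⊔ Ideal.span {X v} := by
  apply le_antisymm
  · rw [JI, Ideal.span_le]
    rintro _ ⟨s, hs, rfl⟩
    by_cases hv : s v = 0
    · apply Ideal.mem_sup_left
      refine Ideal.subset_span ⟨s, ?_, rfl⟩
      rcases hs with ⟨u, hu, h⟩ | h
      · left
        refine ⟨u, ?_, h⟩
        rcases hu with rfl | hu
        · exact absurd hv h
        · exact hu
      · exact Or.inr h
    · exact Ideal.mem_sup_right (Ideal.mem_span_singleton.2 (X_dvd_monomial' hv))
  · rw [sup_le_iff]
    constructor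
    · refine Ideal.span_mono (Set.image_mono ?_)
      rintro s (⟨u, hu, h⟩ | h)
      · exact Or.inl ⟨u, Or.inr hu, h⟩
      · exact Or.inr h
    · rw [Ideal.span_singleton_le_iff_mem]
      refine Ideal.subset_span ⟨Finsupp.single v 1, Or.inl ⟨v, Or.inl rfl, by simp⟩, rfl⟩

lemma JI_colon (K : Type u) [Field K] {n : ℕ} (k : ℕ) (U : Set (Fin n)) (v : Fin n) (hv : v ∉ U)
    (g : MvPolynomial (Fin n) K) :
    g ∈ JI K k (U ∪ {w | padj k v w}) ↔ X v * g ∈ JI K k U := by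
  rw [mem_JI, mem_JI, support_X_mul]
  simp only [Finset.mem_map, addLeftEmbedding_apply, forall_exists_index, and_imp,
    forall_apply_eq_imp_iff₂]
  refine forall₂_congr fun s _ => ?_
  have hne : ∀ i, i ≠ v → ((Finsupp.single v 1 + s : Fin n →₀ ℕ)) i = s i := by
    intro i hi
    simp [Finsupp.single_apply, hi.symm]
  have hvv : ((Finsupp.single v 1 + s : Fin n →₀ ℕ)) v ≠ 0 := by simp
  have hle : ∀ i, s i ≠ 0 → ((Finsupp.single v 1 + s : Fin n →₀ ℕ)) i ≠ 0 := by
    intro i hi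
    simp [hi]
  constructor
  · rintro (⟨u, hu | hu, h⟩ | ⟨i, j, hij, hi, hj⟩)
    · exact Or.inl ⟨u, hu, hle u h⟩
    · exact Or.inr ⟨v, u, hu, hvv, hle u h⟩
    · exact Or.inr ⟨i, j, hij, hle i hi, hle j hj⟩
  · rintro (⟨u, hu, h⟩ | ⟨i, j, hij, hi, hj⟩)
    · refine Or.inl ⟨u, Or.inl hu, ?_⟩
      rwa [hne] at h
      rintro rfl
      exact hv hu
    · by_cases hiv : i = v
      · subst hiv
        rw [hne j hij.1.symm] at hj
        exact Or.inl ⟨j, Or.inr hij, hj⟩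
      · by_cases hjv : j = v
        · subst hjv
          rw [hne i hiv] at hi
          exact Or.inl ⟨i, Or.inr hij.symm, hi⟩
        · rw [hne i hiv] at hi
          rw [hne j hjv] at hj
          exact Or.inr ⟨i, j, hij, hi, hj⟩

lemma JI_colon_iso (K : Type u) [Field K] {n : ℕ} (k : ℕ) (U : Set (Fin n)) (v : Fin n)
    (hv : v ∉ U) (hiso : ∀ w, padj k v w → w ∈ U)
    (g : MvPolynomial (Fin n) K) (h : X v * g ∈ JI K k U) : g ∈ JI K k U := by
  rw [← JI_colon K k U v hv] at h
  have h2 : U ∪ {w | padj k v w} = U := Set.union_eq_left.2 (fun w hw => hiso w hw)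
  rwa [h2] at h

/-- maximal ideal -/
noncomputable abbrev mx (K : Type u) [Field K] (n : ℕ) : Ideal (MvPolynomial (Fin n) K) :=
  Ideal.span (Set.range (X (R := K) (σ := Fin n)))

lemma mem_mx {K : Type u} [Field K] {n : ℕ} {f : MvPolynomial (Fin n) K} :
    f ∈ mx K n ↔ constantCoeff f = 0 := by
  rw [mx, ← Set.image_univ, mem_ideal_span_X_image]
  rw [constantCoeff_eq]
  constructor
  · intro h
    by_contra h0
    obtain ⟨i, -, hi⟩ := h 0 (mem_support_iff.2 h0)
    simp at hi
  · intro h s hs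
    by_contra! hcon
    have : s = 0 := by
      ext i
      exact hcon i trivial
    rw [this, mem_support_iff] at hs
    exact hs h

lemma mx_ne_top (K : Type u) [Field K] (n : ℕ) : mx K n ≠ ⊤ := by
  rw [Ne, Ideal.eq_top_iff_one, mem_mx]
  simp

lemma mx_eq_ker (K : Type u) [Field K] (n : ℕ) :
    mx K n = RingHom.ker (constantCoeff (R := K) (σ := Fin n)) := by
  ext f
  rw [mem_mx, RingHom.mem_ker]

lemma JI_le (K : Type u) [Field K] {n : ℕ} (k : ℕ) (U : Set (Fin n)) : JI K k U ≤ mx K n := by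
  rw [JI, Ideal.span_le]
  rintro _ ⟨s, hs, rfl⟩
  have : ∃ i, s i ≠ 0 := by
    rcases hs with ⟨u, _, h⟩ | ⟨i, _, _, h, _⟩
    exacts [⟨u, h⟩, ⟨i, h⟩]
  obtain ⟨i, hi⟩ := this
  exact Ideal.mem_of_dvd _ (X_dvd_monomial' hi) (Ideal.subset_span ⟨i, rfl⟩)

/-- maximal independent sets of the induced graph on `W` -/
def MaxInd {n : ℕ} (k : ℕ) (W T : Finset (Fin n)) : Prop :=
  T ⊆ W ∧ (∀ i ∈ T, ∀ j ∈ T, ¬ padj k i j) ∧ ∀ w ∈ W, w ∉ T → ∃ t ∈ T, padj k w t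

lemma lower (K : Type u) [Field K] {n : ℕ} (k : ℕ) : ∀ (c : ℕ) (W : Finset (Fin n)) (d : ℕ),
    W.card = c → (∀ T, MaxInd k W T → d ≤ T.card) → HasReg (mx K n) (JI K k {i | i ∉ W}) d := by
  classical
  intro c
  induction c using Nat.strong_induction_on with
  | _ c ih =>
  intro W d hc hW
  have zero : HasReg (mx K n) (JI K k {i | i ∉ W}) 0 := by
    refine ⟨[], rfl, by simp, ?_⟩
    have : Nontrivial (MvPolynomial (Fin n) K ⧸ JI K k {i | i ∉ W}) := by
      apply Ideal.Quotient.nontrivial_iff.2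
      intro h
      exact mx_ne_top K n (top_le_iff.1 (h ▸ JI_le K k {i | i ∉ W}))
    exact RingTheory.Sequence.IsRegular.nil _ _
  by_cases hiso : ∃ v ∈ W, ∀ w ∈ W, ¬ padj k v w
  · obtain ⟨v, hv, hvw⟩ := hiso
    rcases d with _ | d
    · exact zero
    have hset : {i | i ∉ W.erase v} = insert v {i | i ∉ W} := by
      ext i
      by_cases hi : i = v <;> simp [hi]
    refine HasReg.cons (x := X v) (B := JI K k {i | i ∉ W.erase v}) (Ideal.subset_span ⟨v, rfl⟩)
      (JI_colon_iso K k _ v (by simpa using hv) ?_) ?_ ?_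
    · intro w hw hwW
      exact hvw w hwW hw
    · rw [hset, JI_insert]
    · refine ih (W.erase v).card (by rw [← hc]; exact Finset.card_erase_lt_of_mem hv) _ d rfl ?_
      rintro T ⟨h1, h2, h3⟩
      have hvT : v ∉ T := fun h => by simpa using h1 h
      have := hW (insert v T) ⟨?_, ?_, ?_⟩
      · rw [Finset.card_insert_of_notMem hvT] at this
        omega
      · intro t ht
        rcases Finset.mem_insert.1 ht with rfl | ht
        · exact hv
        · exact Finset.mem_of_mem_erase (h1 ht)
      · intro i hi j hj hij
        rcases Finset.mem_insert.1 hi with rfl | hi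
        · rcases Finset.mem_insert.1 hj with rfl | hj
          · exact hij.1 rfl
          · exact hvw j (Finset.mem_of_mem_erase (h1 hj)) hij
        · rcases Finset.mem_insert.1 hj with hjv | hj
          · subst hjv
            exact hvw i (Finset.mem_of_mem_erase (h1 ‹i ∈ T›)) hij.symm
          · exact h2 i hi j hj hij
      · intro w hw hwT
        rw [Finset.mem_insert, not_or] at hwT
        obtain ⟨t, ht, h⟩ := h3 w (Finset.mem_erase.2 ⟨hwT.1, hw⟩) hwT.2
        exact ⟨t, Finset.mem_insert_of_mem ht, h⟩
  · push Not at hiso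
    rcases W.eq_empty_or_nonempty with rfl | hne
    · have := hW ∅ ⟨le_rfl, by simp, by simp⟩
      have hd : d = 0 := by simpa using this
      rw [hd]
      exact zero
    · let s := W.min' hne
      have hs : s ∈ W := W.min'_mem hne
      have hsmin : ∀ w ∈ W, (s : ℕ) ≤ w := fun w hw => W.min'_le w hw
      obtain ⟨v, hv, hsv⟩ := hiso s hs
      have hset : {i | i ∉ W.erase v} = insert v {i | i ∉ W} := by
        ext i
        by_cases hi : i = v <;> simp [hi]
      have hset2 : {i | i ∉ W.filter (fun w => ¬ padj k v w)}
          = {i | i ∉ W} ∪ {w | padj k v w} := by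
        ext i
        simp only [Finset.mem_filter, not_and, not_not, Set.mem_ofPred_eq, Set.mem_union]
        tauto
      refine HasReg.of_ses (x := X v) (A := JI K k {i | i ∉ W.filter (fun w => ¬ padj k v w)})
        (B := JI K k {i | i ∉ W.erase v}) (mx_ne_top K n) (JI_le _ _ _) (JI_le _ _ _)
        (JI_le _ _ _) ?_ ?_ ?_ ?_
      · intro g
        rw [hset2]
        exact JI_colon K k _ v (by simpa using hv) g
      · rw [hset, JI_insert]
      · refine ih _ ?_ _ d rfl ?_
        · rw [← hc]
          apply Finset.card_lt_card
          rw [Finset.filter_ssubset]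
          exact ⟨s, hs, by simpa using hsv.symm⟩
        · rintro T ⟨h1, h2, h3⟩
          refine hW T ⟨fun t ht => (Finset.mem_filter.1 (h1 ht)).1, h2, ?_⟩
          intro w hw hwT
          by_cases hvw : padj k v w
          · refine ⟨v, ?_, hvw.symm⟩
            by_contra hvT
            obtain ⟨t, ht, h⟩ := h3 v (Finset.mem_filter.2 ⟨hv, fun h => h.1 rfl⟩) hvT
            exact (Finset.mem_filter.1 (h1 ht)).2 h
          · exact h3 w (Finset.mem_filter.2 ⟨hw, hvw⟩) hwT
      · refine ih _ (by rw [← hc]; exact Finset.card_erase_lt_of_mem hv) _ d rfl ?_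
        rintro T ⟨h1, h2, h3⟩
        have hvT : v ∉ T := fun h => by simpa using h1 h
        refine hW T ⟨fun t ht => Finset.mem_of_mem_erase (h1 ht), h2, ?_⟩
        intro w hw hwT
        by_cases hwv : w = v
        · subst hwv
          have : ∃ t ∈ T, (t : ℕ) ≤ s + k := by
            by_cases hsT : s ∈ T
            · exact ⟨s, hsT, by omega⟩
            · obtain ⟨t, ht, h⟩ := h3 s (Finset.mem_erase.2 ⟨hsv.1, hs⟩) hsT
              exact ⟨t, ht, h.2.2⟩
          obtain ⟨t, ht, h⟩ := this
          have h4 := hsmin t (Finset.mem_of_mem_erase (h1 ht))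
          have h5 := hsmin w hw
          refine ⟨t, ht, ?_, ?_, ?_⟩
          · rintro rfl
            exact hvT ht
          · have := hsv.2.2
            omega
          · omega
        · exact h3 w (Finset.mem_erase.2 ⟨hwv, hw⟩) hwT

lemma card_bound {n k : ℕ} {T : Finset (Fin n)} (hT : MaxInd k Finset.univ T) :
    n ≤ T.card * (2 * k + 1) := by
  classical
  have h1 : Finset.range n ⊆ T.biUnion fun t => Finset.Icc ((t : ℕ) - k) (t + k) := by
    intro i hi
    rw [Finset.mem_range] at hi
    rw [Finset.mem_biUnion]
    by_cases h : (⟨i, hi⟩ : Fin n) ∈ T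
    · exact ⟨_, h, by simp⟩
    · obtain ⟨t, ht, h⟩ := hT.2.2 ⟨i, hi⟩ (Finset.mem_univ _) h
      refine ⟨t, ht, ?_⟩
      have h2 := h.2.1
      have h3 := h.2.2
      simp only [Finset.mem_Icc] at *
      omega
  have h2 := Finset.card_le_card h1
  rw [Finset.card_range] at h2
  refine h2.trans (Finset.card_biUnion_le_card_mul _ _ _ ?_)
  intro t _
  rw [Nat.card_Icc]
  omega

lemma lower_bound (K : Type u) [Field K] (n k : ℕ) :
    HasReg (mx K n) (pathIdeal K n k) ((n + 2 * k) / (2 * k + 1)) := by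
  have := lower K k _ (Finset.univ : Finset (Fin n)) ((n + 2 * k) / (2 * k + 1)) rfl ?_
  · rw [pathIdeal_eq]
    simpa using this
  · intro T hT
    have := card_bound hT
    rw [← Nat.lt_add_one_iff, Nat.div_lt_iff_lt_mul (by omega)]
    nlinarith

lemma assoc_of_maxInd (K : Type u) [Field K] (n k : ℕ) (T : Finset (Fin n))
    (hT : MaxInd k Finset.univ T) : ∃ p ∈ associatedPrimes (MvPolynomial (Fin n) K)
      (MvPolynomial (Fin n) K ⧸ pathIdeal K n k), p ≤ mx K n ∧
      ringKrullDim (MvPolynomial (Fin n) K ⧸ p) = (T.card : WithBot ℕ∞) := by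
  classical
  let φ : MvPolynomial (Fin n) K →ₐ[K] MvPolynomial T K :=
    aeval (fun i => if h : i ∈ T then X ⟨i, h⟩ else 0)
  let ι : MvPolynomial T K →ₐ[K] MvPolynomial (Fin n) K := rename Subtype.val
  have hφι : ∀ g, φ (ι g) = g := by
    intro g
    have : φ.comp ι = AlgHom.id K _ := by
      ext i
      simp [φ, ι]
    exact AlgHom.congr_fun this g
  have hsurj : Function.Surjective φ := fun g => ⟨ι g, hφι g⟩
  let f : MvPolynomial T K := ∏ t : T, X t
  have hf : f ≠ 0 := Finset.prod_ne_zero_iff.2 fun t _ => X_ne_zero t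
  let F := ι f
  have hφI : ∀ g ∈ pathIdeal K n k, φ g = 0 := by
    intro g hg
    have : pathIdeal K n k ≤ RingHom.ker φ := by
      rw [pathIdeal, Ideal.span_le]
      rintro _ ⟨i, j, hij, hk, rfl⟩
      rw [SetLike.mem_coe, RingHom.mem_ker, map_mul]
      by_cases hi : i ∈ T
      · by_cases hj : j ∈ T
        · exfalso
          refine hT.2.1 i hi j hj ⟨?_, by omega, by omega⟩
          rintro rfl
          omega
        · simp [φ, hj]
      · simp [φ, hi]
    exact this hg
  have hXF : ∀ i, i ∉ T → X i * F ∈ pathIdeal K n k := by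
    intro i hi
    obtain ⟨t, ht, h⟩ := hT.2.2 i (Finset.mem_univ _) hi
    have h1 : (X t : MvPolynomial (Fin n) K) ∣ F := by
      have : ι (X ⟨t, ht⟩) ∣ ι f := map_dvd ι (Finset.dvd_prod_of_mem _ (Finset.mem_univ _))
      simpa [ι] using this
    have h2 : (X i * X t : MvPolynomial (Fin n) K) ∈ pathIdeal K n k := by
      rcases lt_or_gt_of_ne h.1 with h3 | h3
      · exact Ideal.subset_span ⟨i, t, h3, by have := h.2.2; omega, rfl⟩
      · exact Ideal.subset_span ⟨t, i, h3, by have := h.2.1; omega, mul_comm _ _⟩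
    exact Ideal.mem_of_dvd _ (mul_dvd_mul_left _ h1) h2
  have hcong : ∀ g, (g - ι (φ g)) * F ∈ pathIdeal K n k := by
    intro g
    induction g using MvPolynomial.induction_on with
    | C a => simp [φ, ι]
    | add p q hp hq =>
      have := Ideal.add_mem _ hp hq
      rw [map_add, map_add]
      convert this using 1
      ring
    | mul_X p i hp =>
      rw [map_mul, map_mul]
      by_cases hi : i ∈ T
      · have h1 : ι (φ (X i)) = X i := by simp [φ, ι, hi]
        rw [h1]
        convert Ideal.mul_mem_left _ (X i) hp using 1
        ring
      · have h1 : ι (φ (X i)) = 0 := by simp [φ, hi]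
        rw [h1]
        convert Ideal.mul_mem_left _ p (hXF i hi) using 1
        ring
  have hmem : ∀ g, g ∈ RingHom.ker φ ↔ g * F ∈ pathIdeal K n k := by
    intro g
    rw [RingHom.mem_ker]
    constructor
    · intro hg
      have := hcong g
      rwa [hg, map_zero, sub_zero] at this
    · intro hg
      have := hφI _ hg
      rw [map_mul, hφι] at this
      exact (mul_eq_zero.1 this).resolve_right hf
  refine ⟨RingHom.ker φ, ?_, ?_, ?_⟩
  · rw [AssociatedPrimes.mem_iff, isAssociatedPrime_iff]
    refine ⟨RingHom.ker_isPrime _, Submodule.Quotient.mk F, ?_⟩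
    ext g
    rw [Submodule.mem_colon_singleton, Submodule.mem_bot, ← Submodule.Quotient.mk_smul,
      Submodule.Quotient.mk_eq_zero, hmem, smul_eq_mul]
  · intro g hg
    rw [mem_mx]
    have h1 : (constantCoeff (φ g)) = constantCoeff g := by
      have : (constantCoeff (R := K)).comp φ.toRingHom = constantCoeff := by
        apply MvPolynomial.ringHom_ext
        · intro a
          simp [φ]
        · intro i
          by_cases hi : i ∈ T <;> simp [φ, hi]
      exact RingHom.congr_fun this g
    rw [← h1, RingHom.mem_ker.1 hg, map_zero]
  · rw [ringKrullDim_eq_of_ringEquiv (Ideal.quotientKerAlgEquivOfSurjective hsurj).toRingEquiv,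
      MvPolynomial.ringKrullDim_of_isNoetherianRing]
    simp

lemma exists_maxInd (n k : ℕ) (hn : 1 ≤ n) :
    ∃ T : Finset (Fin n), MaxInd k Finset.univ T ∧ T.card ≤ (n + 2 * k) / (2 * k + 1) := by
  classical
  let r := (n + 2 * k) / (2 * k + 1)
  have hr1 : r * (2 * k + 1) ≤ n + 2 * k := Nat.div_mul_le_self _ _
  have hr2 : n + 2 * k < (r + 1) * (2 * k + 1) := by
    rw [← Nat.div_lt_iff_lt_mul (by omega)]
    exact Nat.lt_succ_self _
  let c : ℕ → Fin n := fun i => ⟨min (k + i * (2 * k + 1)) (n - 1), by omega⟩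
  have hmul : ∀ i j, i < j → i * (2 * k + 1) + (2 * k + 1) ≤ j * (2 * k + 1) := by
    intro i j hij
    have := Nat.mul_le_mul_right (2 * k + 1) (Nat.succ_le_of_lt hij)
    rw [Nat.succ_mul] at this
    exact this
  rw [add_mul, one_mul] at hr2
  have hind : ∀ i j, i < j → j < r → ¬ padj k (c i) (c j) := by
    rintro i j hij hj ⟨h1, h2, h3⟩
    have := hmul i j hij
    have := hmul j r hj
    simp only [c] at h3
    omega
  refine ⟨(Finset.range r).image c, ⟨Finset.subset_univ _, ?_, ?_⟩, ?_⟩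
  · intro a ha b hb hab
    obtain ⟨i, hi, rfl⟩ := Finset.mem_image.1 ha
    obtain ⟨j, hj, rfl⟩ := Finset.mem_image.1 hb
    rcases lt_trichotomy i j with h | h | h
    · exact hind i j h (Finset.mem_range.1 hj) hab
    · exact hab.1 (by rw [h])
    · exact hind j i h (Finset.mem_range.1 hi) hab.symm
  · intro w _ hwT
    have hw := w.2
    have hdiv := Nat.div_add_mod (w : ℕ) (2 * k + 1)
    have hmod := Nat.mod_lt (w : ℕ) (show 0 < 2 * k + 1 by omega)
    rw [mul_comm] at hdiv
    set q := (w : ℕ) / (2 * k + 1) with hq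
    have hqr : q < r := by
      by_contra! h
      have := Nat.mul_le_mul_right (2 * k + 1) h
      omega
    have hcT : c q ∈ (Finset.range r).image c :=
      Finset.mem_image_of_mem _ (Finset.mem_range.2 hqr)
    refine ⟨c q, hcT, ?_, ?_, ?_⟩
    · intro h
      rw [h] at hwT
      exact hwT hcT
    · simp only [c]
      omega
    · simp only [c]
      omega
  · exact Finset.card_image_le.trans (by rw [Finset.card_range])

theorem stmt9 (K : Type*) [Field K] (n k : ℕ) (hn : 2 ≤ n) (hk : 1 ≤ k) :
    pdepth (pathIdeal K n k) = (((n + 2 * k) / (2 * k + 1) : ℕ) : ℕ∞) := by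
  apply le_antisymm
  · apply sSup_le
    rintro d ⟨rs, hrs, hreg, rfl⟩
    obtain ⟨T, hT, hcard⟩ := exists_maxInd n k (by omega)
    obtain ⟨p, hp, hpm, hdim⟩ := assoc_of_maxInd K n k T hT
    have : (mx K n).IsPrime := by
      rw [mx_eq_ker]
      exact RingHom.ker_isPrime _
    have h := length_le_dim (mx K n) rs _ hrs hreg p hp hpm
    rw [hdim] at h
    have h' : rs.length ≤ T.card := by exact_mod_cast h
    exact_mod_cast h'.trans hcard
  · obtain ⟨rs, hl, hr, hreg⟩ := lower_bound K n k
    apply le_sSup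
    exact ⟨rs, hr, hreg.toIsWeaklyRegular, by rw [hl]⟩
end

section
/- Let $k \ge 1$ and $n \ge 2k+2$ with $n \equiv 0$ or $n \equiv r \pmod{2k+1}$ for some $r$ with $k+1 \le r \le 2k$. Then $\operatorname{depth}(S/I(C_n^k)) = \lceil n/(2k+1) \rceil$. Moreover, for any $n \ge 2k+2$, $\lceil n/(2k+1)\rceil - 1 \le \operatorname{depth}(S/I(C_n^k)) \le \lceil n/(2k+1) \rceil$. -/
open MvPolynomial

section helpA
open MvPolynomial

theorem len_le_dim {R : Type*} [CommRing R] [IsNoetherianRing R] (m : Ideal R) [hm : m.IsMaximal]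
    (rs : List R) : ∀ (M : Type _) [AddCommGroup M] [Module R M] [Module.Finite R M]
    (_ : ∀ r ∈ rs, r ∈ m) (_ : RingTheory.Sequence.IsWeaklyRegular M rs)
    (x : M) (_ : ∀ s : R, s • x = 0 → s ∈ m) (J : Ideal R) (_ : ∀ s ∈ J, s • x = 0),
    (rs.length : WithBot ℕ∞) ≤ ringKrullDim (R ⧸ J) := by
  induction rs with
  | nil =>
    intro M _ _ _ _ _ x hx J hJ
    have : Nontrivial (R ⧸ J) := by
      apply Ideal.Quotient.nontrivial_iff.mpr
      intro h
      exact hm.ne_top ((Ideal.eq_top_iff_one _).2 (hx 1 (hJ 1 (by rw [h]; trivial))))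
    simpa using ringKrullDim_nonneg_of_nontrivial
  | cons r rs ih =>
    intro M _ _ _ hmem hreg x hx J hJ
    rw [RingTheory.Sequence.isWeaklyRegular_cons_iff] at hreg
    obtain ⟨hr, hreg⟩ := hreg
    have hle : (⊥ : Submodule R M).colon {x} ≤ m := by
      intro s hs
      rw [Submodule.mem_colon_singleton] at hs
      exact hx s (by simpa using hs)
    obtain ⟨P, hP, hPm⟩ := Ideal.exists_minimalPrimes_le hle
    have hPp : P.IsPrime := hP.1.1
    obtain ⟨y, hy⟩ := Submodule.exists_eq_colon_of_mem_minimalPrimes hP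
    have hy' : ∀ s, s ∈ P ↔ s • y = 0 := by
      intro s
      rw [hy, Submodule.mem_colon_singleton]; simp
    have hJP : J ≤ P := fun s hs => hP.1.2 (by
      rw [Submodule.mem_colon_singleton]; simpa using hJ s hs)
    have hrm : r ∈ m := hmem r (by simp)
    let N : Submodule R M := Submodule.torsionBySet R M (P : Set R)
    have hN : ∀ z, z ∈ N ↔ ∀ p ∈ P, p • z = 0 := by
      intro z
      simp [N, Submodule.mem_torsionBySet_iff]
    have key : ∃ z ∈ N, ∀ s : R, (∃ w, s • z = r • w) → s ∈ m := by
      by_contra hcon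
      push Not at hcon
      have hNN : N ≤ m • N := by
        intro z hz
        obtain ⟨s, ⟨w, hw⟩, hs⟩ := hcon z hz
        have hwN : w ∈ N := by
          rw [hN] at hz ⊢
          intro p hp
          apply hr
          change r • (p • w) = r • (0 : M)
          rw [smul_comm, ← hw, smul_comm, hz p hp]; simp
        obtain ⟨t, ht⟩ := hm.exists_inv hs
        obtain ⟨i, hi, ht⟩ := ht
        have : z = t • (r • w) + i • z := by
          rw [← hw, ← mul_smul, ← add_smul, ht, one_smul]
        rw [this]
        refine add_mem ?_ (Submodule.smul_mem_smul hi hz)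
        exact Submodule.smul_mem _ _ (Submodule.smul_mem_smul hrm hwN)
      obtain ⟨u, hu, hu0⟩ := Submodule.exists_sub_one_mem_and_smul_eq_zero_of_fg_of_le_smul m N
        (IsNoetherian.noetherian N) hNN
      have hyN : y ∈ N := (hN y).2 fun p hp => (hy' p).1 hp
      have hum : u ∈ m := hPm ((hy' u).2 (hu0 y hyN))
      apply hm.ne_top
      rw [Ideal.eq_top_iff_one]
      have := sub_mem hum hu
      simpa using this
    obtain ⟨z, hzN, hz⟩ := key
    have h1 := ih (QuotSMulTop r M) (fun s hs => hmem s (by simp [hs])) hreg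
      (Submodule.Quotient.mk z) ?_ (P ⊔ Ideal.span {r}) ?_
    · have hrP : r ∉ P := by
        intro h
        have hy0 : y = 0 := hr (by simpa using (hy' r).1 h)
        exact hPp.ne_top ((Ideal.eq_top_iff_one _).2 ((hy' 1).2 (by simp [hy0])))
      have h2 : ringKrullDim (R ⧸ (P ⊔ Ideal.span {r})) + 1 ≤ ringKrullDim (R ⧸ P) := by
        refine ringKrullDim_succ_le_of_surjective (Ideal.Quotient.factor (le_sup_left))
          (Ideal.Quotient.factor_surjective _) (r := Ideal.Quotient.mk P r) ?_ ?_
        · rw [mem_nonZeroDivisors_iff_ne_zero]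
          rwa [Ne, Ideal.Quotient.eq_zero_iff_mem]
        · rw [Ideal.Quotient.factor_mk, Ideal.Quotient.eq_zero_iff_mem]
          exact Ideal.mem_sup_right (Ideal.mem_span_singleton_self r)
      have h3 : ringKrullDim (R ⧸ P) ≤ ringKrullDim (R ⧸ J) :=
        ringKrullDim_le_of_surjective (Ideal.Quotient.factor hJP)
          (Ideal.Quotient.factor_surjective _)
      refine le_trans ?_ (h2.trans h3)
      push_cast [List.length_cons]
      gcongr
    · intro s hs
      rw [← Submodule.Quotient.mk_smul, Submodule.Quotient.mk_eq_zero] at hs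
      obtain ⟨w, -, hw⟩ := hs
      exact hz s ⟨w, hw.symm⟩
    · intro s hs
      rw [← Submodule.Quotient.mk_smul, Submodule.Quotient.mk_eq_zero]
      obtain ⟨p, hp, q, hq, rfl⟩ := Submodule.mem_sup.1 hs
      obtain ⟨q, rfl⟩ := Ideal.mem_span_singleton.1 hq
      rw [add_smul, (hN z).1 hzN p hp, zero_add, mul_smul]
      exact Submodule.smul_mem_pointwise_smul _ _ _ trivial

end helpA

section helpB

/-- The ideal generated by the variables outside `A` and by the edges of `E`. -/
noncomputable def vIdeal (K : Type*) [Field K] {n : ℕ} (E : Fin n → Fin n → Prop)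
    (A : Set (Fin n)) : Ideal (MvPolynomial (Fin n) K) :=
  Ideal.span ({m | ∃ i, i ∉ A ∧ m = X i} ∪ {m | ∃ i j, E i j ∧ m = X i * X j})

theorem mem_vIdeal {K : Type*} [Field K] {n : ℕ} {E : Fin n → Fin n → Prop}
    (hE : ∀ i, ¬ E i i) {A : Set (Fin n)} (f : MvPolynomial (Fin n) K) :
    f ∈ vIdeal K E A ↔ ∀ s ∈ f.support, (∃ i, i ∉ A ∧ s i ≠ 0) ∨
      (∃ i j, E i j ∧ s i ≠ 0 ∧ s j ≠ 0) := by
  have h : vIdeal K E A = Ideal.span ((fun s => monomial s (1 : K)) ''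
      ({s | ∃ i, i ∉ A ∧ s = Finsupp.single i 1} ∪
       {s | ∃ i j, E i j ∧ s = Finsupp.single i 1 + Finsupp.single j 1})) := by
    unfold vIdeal
    congr 1
    ext m
    constructor
    · rintro (⟨i, hi, rfl⟩ | ⟨i, j, hij, rfl⟩)
      · exact ⟨_, Or.inl ⟨i, hi, rfl⟩, rfl⟩
      · refine ⟨_, Or.inr ⟨i, j, hij, rfl⟩, ?_⟩
        simp [X, monomial_mul]
    · rintro ⟨s, (⟨i, hi, rfl⟩ | ⟨i, j, hij, rfl⟩), rfl⟩
      · exact Or.inl ⟨i, hi, rfl⟩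
      · refine Or.inr ⟨i, j, hij, ?_⟩
        simp [X, monomial_mul]
  rw [h, mem_ideal_span_monomial_image]
  refine forall₂_congr fun s _ => ?_
  constructor
  · rintro ⟨t, (⟨i, hi, rfl⟩ | ⟨i, j, hij, rfl⟩), hle⟩
    · refine Or.inl ⟨i, hi, ?_⟩
      have := hle i
      simp at this; omega
    · refine Or.inr ⟨i, j, hij, ?_, ?_⟩
      · have := hle i
        simp at this; omega
      · have := hle j
        simp at this; omega
  · rintro (⟨i, hi, h⟩ | ⟨i, j, hij, h1, h2⟩)
    · refine ⟨_, Or.inl ⟨i, hi, rfl⟩, ?_⟩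
      rw [Finsupp.single_le_iff]; omega
    · refine ⟨_, Or.inr ⟨i, j, hij, rfl⟩, ?_⟩
      have hne : i ≠ j := fun h => hE i (h ▸ hij)
      intro a
      simp only [Finsupp.add_apply, Finsupp.single_apply]
      split_ifs with h3 h4 h4
      · exact absurd (h3.trans h4.symm) hne
      · subst h3; omega
      · subst h4; omega
      · omega

theorem vIdeal_colon {K : Type*} [Field K] {n : ℕ} {E : Fin n → Fin n → Prop}
    (hE : ∀ i, ¬ E i i) (hs : ∀ i j, E i j → E j i) {A : Set (Fin n)} {v : Fin n} (hv : v ∈ A)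
    (f : MvPolynomial (Fin n) K) :
    f * X v ∈ vIdeal K E A ↔ f ∈ vIdeal K E {i | i ∈ A ∧ ¬ E v i} := by
  rw [mem_vIdeal hE, mem_vIdeal hE, support_mul_X]
  simp only [Finset.mem_map, forall_exists_index, and_imp, forall_apply_eq_imp_iff₂,
    addRightEmbedding_apply]
  refine forall₂_congr fun s _ => ?_
  have hne : ∀ i, i ≠ v → (s + Finsupp.single v 1 : Fin n →₀ ℕ) i = s i := by
    intro i hi
    simp [Ne.symm hi]
  have hvv : (s + Finsupp.single v 1 : Fin n →₀ ℕ) v ≠ 0 := by simp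
  have hmono : ∀ i, s i ≠ 0 → (s + Finsupp.single v 1 : Fin n →₀ ℕ) i ≠ 0 := by
    intro i hi
    simp [hi]
  constructor
  · rintro (⟨i, hi, h⟩ | ⟨i, j, hij, h1, h2⟩)
    · have : i ≠ v := fun h => hi (h ▸ hv)
      rw [hne i this] at h
      exact Or.inl ⟨i, fun h => hi h.1, h⟩
    · by_cases hi : i = v
      · have hj : j ≠ v := fun h => hE v (by rw [hi, h] at hij; exact hij)
        rw [hne j hj] at h2
        exact Or.inl ⟨j, fun h => h.2 (hi ▸ hij), h2⟩
      · by_cases hj : j = v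
        · rw [hne i hi] at h1
          exact Or.inl ⟨i, fun h => h.2 (hj ▸ hs _ _ hij), h1⟩
        · rw [hne i hi] at h1
          rw [hne j hj] at h2
          exact Or.inr ⟨i, j, hij, h1, h2⟩
  · rintro (⟨i, hi, h⟩ | ⟨i, j, hij, h1, h2⟩)
    · by_cases hiA : i ∈ A
      · have : E v i := by
          by_contra hc
          exact hi ⟨hiA, hc⟩
        exact Or.inr ⟨v, i, this, hvv, hmono _ h⟩
      · exact Or.inl ⟨i, hiA, hmono _ h⟩
    · exact Or.inr ⟨i, j, hij, hmono _ h1, hmono _ h2⟩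

theorem vIdeal_sup {K : Type*} [Field K] {n : ℕ} {E : Fin n → Fin n → Prop}
    {A : Set (Fin n)} {v : Fin n} :
    vIdeal K E A ⊔ Ideal.span {X v} = vIdeal K E (A \ {v}) := by
  unfold vIdeal
  rw [← Ideal.span_union]
  congr 1
  ext m
  constructor
  · rintro ((⟨i, hi, rfl⟩ | h) | rfl)
    · exact Or.inl ⟨i, fun h => hi h.1, rfl⟩
    · exact Or.inr h
    · exact Or.inl ⟨v, fun h => h.2 rfl, rfl⟩
  · rintro (⟨i, hi, rfl⟩ | h)
    · by_cases hiv : i = v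
      · subst hiv; exact Or.inr rfl
      · exact Or.inl (Or.inl ⟨i, fun h => hi ⟨h, hiv⟩, rfl⟩)
    · exact Or.inl (Or.inr h)

/-- The maximal graded ideal. -/
noncomputable abbrev mI (K : Type*) [Field K] (n : ℕ) : Ideal (MvPolynomial (Fin n) K) :=
  Ideal.span (Set.range (X (R := K) (σ := Fin n)))

theorem mem_mI {K : Type*} [Field K] {n : ℕ} (f : MvPolynomial (Fin n) K) :
    f ∈ mI K n ↔ constantCoeff f = 0 := by
  have := mem_pow_idealOfVars_iff' (σ := Fin n) (R := K) 1 f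
  rw [pow_one] at this
  rw [this]
  simp [Nat.lt_one_iff, Finsupp.degree_eq_zero_iff, constantCoeff_eq]

instance mI_max (K : Type*) [Field K] (n : ℕ) : (mI K n).IsMaximal := by
  have : mI K n = RingHom.ker (constantCoeff : MvPolynomial (Fin n) K →+* K) := by
    ext f
    rw [mem_mI, RingHom.mem_ker]
  rw [this]
  exact RingHom.ker_isMaximal_of_surjective _ (fun a => ⟨C a, constantCoeff_C _ a⟩)

theorem vIdeal_le {K : Type*} [Field K] {n : ℕ} {E : Fin n → Fin n → Prop}
    {A : Set (Fin n)} : vIdeal K E A ≤ mI K n := by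
  unfold vIdeal
  rw [Ideal.span_le]
  rintro m (⟨i, hi, rfl⟩ | ⟨i, j, hij, rfl⟩)
  · exact Ideal.subset_span ⟨i, rfl⟩
  · exact Ideal.mul_mem_right _ _ (Ideal.subset_span ⟨i, rfl⟩)

universe u

open CategoryTheory Abelian

/-- Depth at least `d`, expressed by vanishing of `Ext`. -/
def ExtDepth {K : Type u} [Field K] {n : ℕ} (d : ℕ) (I : Ideal (MvPolynomial (Fin n) K)) : Prop :=
  ∀ i < d, Subsingleton (Ext (ModuleCat.of (MvPolynomial (Fin n) K)
    (MvPolynomial (Fin n) K ⧸ mI K n)) (ModuleCat.of (MvPolynomial (Fin n) K)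
    (MvPolynomial (Fin n) K ⧸ I)) i)

theorem mI_smul_lt {K : Type u} [Field K] {n : ℕ} {I : Ideal (MvPolynomial (Fin n) K)}
    (hI : I ≤ mI K n) :
    mI K n • (⊤ : Submodule (MvPolynomial (Fin n) K) (MvPolynomial (Fin n) K ⧸ I)) < ⊤ := by
  rw [lt_top_iff_ne_top]
  intro h
  have h1 : (Ideal.Quotient.mk I 1) ∈ mI K n •
    (⊤ : Submodule (MvPolynomial (Fin n) K) (MvPolynomial (Fin n) K ⧸ I)) := by rw [h]; trivial
  have h2 : mI K n • (⊤ : Submodule (MvPolynomial (Fin n) K) (MvPolynomial (Fin n) K ⧸ I)) ≤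
      Submodule.map (Submodule.mkQ I) (mI K n) := by
    rw [Submodule.smul_le]
    intro r hr x _
    obtain ⟨x, rfl⟩ := Submodule.mkQ_surjective _ x
    exact ⟨r * x, Ideal.mul_mem_right _ _ hr, rfl⟩
  obtain ⟨y, hy, hy1⟩ := h2 h1
  have h3 : y - 1 ∈ I := (Ideal.Quotient.mk_eq_mk_iff_sub_mem _ _).1 hy1
  apply (mI_max K n).ne_top
  rw [Ideal.eq_top_iff_one]
  simpa using sub_mem hy (hI h3)

theorem extDepth_iff {K : Type u} [Field K] {n : ℕ} {d : ℕ} {I : Ideal (MvPolynomial (Fin n) K)}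
    (hI : I ≤ mI K n) :
    ExtDepth d I ↔ ∃ rs : List (MvPolynomial (Fin n) K), rs.length = d ∧ (∀ r ∈ rs, r ∈ mI K n) ∧
    RingTheory.Sequence.IsWeaklyRegular (MvPolynomial (Fin n) K ⧸ I) rs := by
  have hsupp : Module.support (MvPolynomial (Fin n) K) (MvPolynomial (Fin n) K ⧸ mI K n) =
      PrimeSpectrum.zeroLocus (mI K n) := by
    rw [Module.support_eq_zeroLocus, Ideal.annihilator_quotient]
  constructor
  · intro h
    obtain ⟨rs, h1, h2, h3⟩ := ModuleCat.exists_isRegular_of_exists_subsingleton_ext (mI K n) d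
      (ModuleCat.of (MvPolynomial (Fin n) K) (MvPolynomial (Fin n) K ⧸ I)) (mI_smul_lt hI)
      (ModuleCat.of (MvPolynomial (Fin n) K) (MvPolynomial (Fin n) K ⧸ mI K n)) hsupp h
    exact ⟨rs, h1, h2, h3.1⟩
  · rintro ⟨rs, rfl, h2, h3⟩
    refine ModuleCat.subsingleton_ext_of_exists_isRegular (mI K n)
      (ModuleCat.of (MvPolynomial (Fin n) K) (MvPolynomial (Fin n) K ⧸ mI K n)) hsupp.le
      (ModuleCat.of (MvPolynomial (Fin n) K) (MvPolynomial (Fin n) K ⧸ I)) (mI_smul_lt hI)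
      rs h2 ⟨h3, ?_⟩
    intro h
    refine (mI_smul_lt hI).ne (top_unique ?_)
    refine h.le.trans ?_
    exact Submodule.smul_mono_left (Ideal.span_le.2 h2)

theorem ext_mid {R : Type u} [CommRing R] (N : ModuleCat.{u} R) (I I1 I2 : Ideal R) (v : R)
    (hc : ∀ f, f * v ∈ I ↔ f ∈ I1) (hsup : I ⊔ Ideal.span {v} = I2) (i : ℕ)
    (s1 : Subsingleton (Ext N (ModuleCat.of R (R ⧸ I1)) i))
    (s2 : Subsingleton (Ext N (ModuleCat.of R (R ⧸ I2)) i)) :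
    Subsingleton (Ext N (ModuleCat.of R (R ⧸ I)) i) := by
  let f : (R ⧸ I1) →ₗ[R] (R ⧸ I) := Submodule.mapQ I1 I (LinearMap.lsmul R R v) (by
    intro g hg
    have := (hc g).2 hg
    rw [mul_comm] at this
    exact this)
  have hle : I ≤ I2 := hsup ▸ le_sup_left
  let g : (R ⧸ I) →ₗ[R] (R ⧸ I2) := Submodule.factor hle
  have hf : Function.Injective f := by
    rw [← LinearMap.ker_eq_bot, LinearMap.ker_eq_bot']
    intro a ha
    obtain ⟨a, rfl⟩ := Submodule.mkQ_surjective _ a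
    have ha' : v * a ∈ I := (Submodule.Quotient.mk_eq_zero _).1 ha
    rw [mul_comm] at ha'
    exact (Submodule.Quotient.mk_eq_zero _).2 ((hc a).1 ha')
  have hg : Function.Surjective g := Submodule.factor_surjective hle
  have hfg : Function.Exact f g := by
    intro a
    obtain ⟨a, rfl⟩ := Submodule.mkQ_surjective _ a
    constructor
    · intro ha
      have ha : a ∈ I2 := (Submodule.Quotient.mk_eq_zero _).1 ha
      rw [← hsup] at ha
      obtain ⟨p, hp, q, hq, rfl⟩ := Submodule.mem_sup.1 ha
      obtain ⟨q, rfl⟩ := Ideal.mem_span_singleton.1 hq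
      refine ⟨Submodule.Quotient.mk q, ?_⟩
      refine (Submodule.Quotient.eq I).2 ?_
      change v * q - (p + v * q) ∈ I
      have : v * q - (p + v * q) = -p := by ring
      rw [this]
      exact neg_mem hp
    · rintro ⟨b, hb⟩
      obtain ⟨b, rfl⟩ := Submodule.mkQ_surjective _ b
      rw [← hb]
      refine (Submodule.Quotient.mk_eq_zero I2).2 ?_
      change v * b ∈ I2
      rw [← hsup]
      exact Ideal.mem_sup_right (Ideal.mul_mem_right _ _ (Ideal.mem_span_singleton_self _))
  let T : ShortComplex (ModuleCat.{u} R) :=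
    ShortComplex.mk (ModuleCat.ofHom f) (ModuleCat.ofHom g)
      (ModuleCat.hom_ext (LinearMap.ext fun x => hfg.apply_apply_eq_zero x))
  have hT : T.ShortExact :=
    { exact := (ShortComplex.ShortExact.moduleCat_exact_iff_function_exact T).2 hfg
      mono_f := (ModuleCat.mono_iff_injective _).2 hf
      epi_g := (ModuleCat.epi_iff_surjective _).2 hg }
  have key : ∀ a : Ext N T.X₂ i, a = 0 := by
    intro a
    obtain ⟨x1, rfl⟩ := Ext.covariant_sequence_exact₂ _ hT a (s2.elim _ _)
    rw [s1.elim x1 0]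
    simp
  exact ⟨fun a b => (key a).trans (key b).symm⟩

theorem extDepth_mid {K : Type u} [Field K] {n : ℕ} {d : ℕ} {E : Fin n → Fin n → Prop}
    (hE : ∀ i, ¬ E i i) (hs : ∀ i j, E i j → E j i) {A : Set (Fin n)} {v : Fin n} (hv : v ∈ A)
    (h1 : ExtDepth d (vIdeal K E {i | i ∈ A ∧ ¬ E v i}))
    (h2 : ExtDepth d (vIdeal K E (A \ {v}))) : ExtDepth d (vIdeal K E A) := fun i hi =>
  ext_mid _ _ _ _ (X v) (vIdeal_colon hE hs hv) vIdeal_sup i (h1 i hi) (h2 i hi)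

open scoped Pointwise in
theorem weaklyReg_quot {R : Type u} [CommRing R] (I : Ideal R) (r : R) (rs : List R)
    (h : RingTheory.Sequence.IsWeaklyRegular (R ⧸ (I ⊔ Ideal.span {r})) rs) :
    RingTheory.Sequence.IsWeaklyRegular (QuotSMulTop r (R ⧸ I)) rs := by
  let φ : R →ₗ[R] QuotSMulTop r (R ⧸ I) :=
    (Submodule.mkQ (r • (⊤ : Submodule R (R ⧸ I)))).comp (Submodule.mkQ I)
  have hφ : Function.Surjective φ :=
    (Submodule.mkQ_surjective _).comp (Submodule.mkQ_surjective _)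
  have hk : I ⊔ Ideal.span {r} = LinearMap.ker φ := by
    ext a
    rw [LinearMap.mem_ker]
    constructor
    · intro ha
      obtain ⟨p, hp, q, hq, rfl⟩ := Submodule.mem_sup.1 ha
      obtain ⟨q, rfl⟩ := Ideal.mem_span_singleton.1 hq
      refine (Submodule.Quotient.mk_eq_zero _).2 ?_
      rw [map_add, (Submodule.Quotient.mk_eq_zero I).2 hp |> (fun h => (h : Submodule.mkQ I p = 0)),
        zero_add]
      exact ⟨Submodule.mkQ I q, trivial, rfl⟩
    · intro ha
      obtain ⟨q, -, hq⟩ := (Submodule.Quotient.mk_eq_zero _).1 ha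
      obtain ⟨q, rfl⟩ := Submodule.mkQ_surjective _ q
      have h1 : r * q - a ∈ I := (Submodule.Quotient.eq I).1 hq
      have h2 : a = -(r * q - a) + r * q := by ring
      rw [h2]
      exact Submodule.add_mem_sup (neg_mem h1)
        (Ideal.mul_mem_right _ _ (Ideal.mem_span_singleton_self _))
  exact (LinearEquiv.isWeaklyRegular_congr ((Submodule.quotEquivOfEq _ _ hk).trans
    (LinearMap.quotKerEquivOfSurjective φ hφ)) rs).1 h

theorem extDepth_isol {K : Type u} [Field K] {n : ℕ} {d : ℕ} {E : Fin n → Fin n → Prop}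
    (hE : ∀ i, ¬ E i i) (hs : ∀ i j, E i j → E j i) {A : Set (Fin n)} {v : Fin n} (hv : v ∈ A)
    (hA : ∀ i ∈ A, ¬ E v i)
    (h2 : ExtDepth d (vIdeal K E (A \ {v}))) : ExtDepth (d + 1) (vIdeal K E A) := by
  rw [extDepth_iff vIdeal_le] at h2 ⊢
  obtain ⟨rs, h1, h2, h3⟩ := h2
  have hAA : {i | i ∈ A ∧ ¬ E v i} = A := by
    ext i; exact ⟨fun h => h.1, fun h => ⟨h, hA i h⟩⟩
  refine ⟨X v :: rs, by simp [h1], ?_, ?_⟩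
  · intro r hr
    rcases List.mem_cons.1 hr with rfl | hr
    · exact Ideal.subset_span ⟨v, rfl⟩
    · exact h2 r hr
  · refine RingTheory.Sequence.IsWeaklyRegular.cons ?_ ?_
    · rw [isSMulRegular_iff_right_eq_zero_of_smul]
      intro a ha
      obtain ⟨a, rfl⟩ := Submodule.mkQ_surjective _ a
      rw [← map_smul, Submodule.mkQ_apply, Submodule.Quotient.mk_eq_zero, smul_eq_mul, mul_comm,
        vIdeal_colon hE hs hv, hAA] at ha
      rwa [Submodule.mkQ_apply, Submodule.Quotient.mk_eq_zero]
    · rw [← vIdeal_sup] at h3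
      exact weaklyReg_quot _ _ _ h3

/-- Adjacency in the `k`-th power of the cycle. -/
def cE (n k : ℕ) (i j : Fin n) : Prop :=
  ((i : ℕ) < j ∧ ((j : ℕ) - i ≤ k ∨ n - k ≤ (j : ℕ) - i)) ∨
  ((j : ℕ) < i ∧ ((i : ℕ) - j ≤ k ∨ n - k ≤ (i : ℕ) - j))

theorem cE_irr (n k : ℕ) (i : Fin n) : ¬ cE n k i i := by
  unfold cE; omega

theorem cE_symm (n k : ℕ) (i j : Fin n) (h : cE n k i j) : cE n k j i := by
  unfold cE at *; omega

theorem vIdeal_univ (K : Type*) [Field K] (n k : ℕ) :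
    vIdeal K (cE n k) Set.univ = cycleIdeal K n k := by
  unfold vIdeal cycleIdeal
  congr 1
  ext m
  constructor
  · rintro (⟨i, hi, rfl⟩ | ⟨i, j, (h | h), rfl⟩)
    · exact absurd trivial hi
    · exact ⟨i, j, h.1, h.2, rfl⟩
    · exact ⟨j, i, h.1, h.2, mul_comm _ _⟩
  · rintro ⟨i, j, h1, h2, rfl⟩
    exact Or.inr ⟨i, j, Or.inl ⟨h1, h2⟩, rfl⟩

theorem extDepth_step {K : Type u} [Field K] {n : ℕ} {d : ℕ} {E : Fin n → Fin n → Prop}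
    (hE : ∀ i, ¬ E i i) (hs : ∀ i j, E i j → E j i) {A B C : Set (Fin n)} (v : Fin n) (hv : v ∈ A)
    (hB : ∀ i, i ∈ B ↔ i ∈ A ∧ ¬ E v i ∧ i ≠ v) (hC : ∀ i, i ∈ C ↔ i ∈ A ∧ i ≠ v)
    (h1 : ExtDepth d (vIdeal K E B)) (h2 : ExtDepth (d + 1) (vIdeal K E C)) :
    ExtDepth (d + 1) (vIdeal K E A) := by
  have e1 : B = {i | i ∈ A ∧ ¬ E v i} \ {v} := by
    ext i; rw [hB]; simp [and_assoc]
  have e2 : C = A \ {v} := by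
    ext i; rw [hC]; simp
  subst e1 e2
  refine extDepth_mid hE hs hv ?_ h2
  exact extDepth_isol hE hs ⟨hv, hE v⟩ (fun i hi => hi.2) h1

theorem extDepth_path {K : Type u} [Field K] {n k : ℕ} : ∀ (d a b : ℕ),
    b ≤ n → b + k ≤ a + n → d * (2 * k + 1) ≤ (b - a) + 2 * k →
    ExtDepth d (vIdeal K (cE n k) {i | a ≤ (i : ℕ) ∧ (i : ℕ) < b}) := by
  intro d
  induction d with
  | zero => intro a b _ _ _ i hi; omega
  | succ d ih =>
    intro a b hbn hab hd
    have hd' : (d + 1) * (2 * k + 1) = d * (2 * k + 1) + (2 * k + 1) := by ring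
    rw [hd'] at hd
    have hlt : a < b := by omega
    have inner : ∀ j ≤ k, ExtDepth (d + 1) (vIdeal K (cE n k)
        {i | (i : ℕ) < b ∧ ((i : ℕ) = a ∨ a + (k - j) + 1 ≤ (i : ℕ))}) := by
      intro j
      induction j with
      | zero =>
        intro _
        refine extDepth_isol (cE_irr n k) (cE_symm n k) (v := ⟨a, by omega⟩) ?_ ?_ ?_
        · exact ⟨hlt, Or.inl rfl⟩
        · rintro i ⟨h1, h2⟩
          simp only [cE]; omega
        · have := ih (a + k + 1) b hbn (by omega) (by omega)
          convert this using 2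
          ext i
          simp only [Set.mem_sdiff, Set.mem_ofPred_eq, Set.mem_singleton_iff, Fin.ext_iff]
          omega
      | succ j ihj =>
        intro hj
        have ihj := ihj (by omega)
        by_cases hb : b ≤ a + (k - j)
        · convert ihj using 2
          ext i
          simp only [Set.mem_ofPred_eq]
          omega
        · refine extDepth_step (cE_irr n k) (cE_symm n k) ⟨a + (k - j), by omega⟩ ?_ ?_ ?_
            (ih (a + (k - j) + k + 1) b hbn (by omega) (by omega)) ihj
          · simp only [Set.mem_ofPred_eq]; omega
          · intro i
            simp only [Set.mem_ofPred_eq, cE, ne_eq, Fin.ext_iff]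
            omega
          · intro i
            simp only [Set.mem_ofPred_eq, ne_eq, Fin.ext_iff]
            omega
    convert inner k le_rfl using 2
    ext i
    simp only [Set.mem_ofPred_eq]
    omega

theorem extDepth_cycle {K : Type u} [Field K] {n k : ℕ} (hn : 2 * k + 2 ≤ n) (d : ℕ)
    (hd : d * (2 * k + 1) ≤ n + k) : ExtDepth d (cycleIdeal K n k) := by
  cases d with
  | zero => intro i hi; omega
  | succ d =>
    have hd' : (d + 1) * (2 * k + 1) = d * (2 * k + 1) + (2 * k + 1) := by ring
    have inner : ∀ j ≤ k, ExtDepth (d + 1) (vIdeal K (cE n k) {i | k - j ≤ (i : ℕ)}) := by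
      intro j
      induction j with
      | zero =>
        intro _
        convert extDepth_path (K := K) (n := n) (k := k) (d + 1) k n le_rfl (by omega) (by omega)
          using 2
        ext i
        simp only [Set.mem_ofPred_eq]
        omega
      | succ j ihj =>
        intro hj
        have ihj := ihj (by omega)
        refine extDepth_step (cE_irr n k) (cE_symm n k) ⟨k - (j + 1), by omega⟩ ?_ ?_ ?_
            (extDepth_path (k - (j + 1) + k + 1) (n + (k - (j + 1)) - k)
              (d := d) (by omega) (by omega) (by omega)) ihj
        · simp only [Set.mem_ofPred_eq]; omega
        · intro i
          simp only [Set.mem_ofPred_eq, cE, ne_eq, Fin.ext_iff]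
          omega
        · intro i
          simp only [Set.mem_ofPred_eq, ne_eq, Fin.ext_iff]
          omega
    have := inner k le_rfl
    rw [← vIdeal_univ]
    convert this using 2
    ext i
    simp

theorem le_pdepth {K : Type u} [Field K] {n k : ℕ} (hn : 2 * k + 2 ≤ n) (d : ℕ)
    (hd : d * (2 * k + 1) ≤ n + k) : (d : ℕ∞) ≤ pdepth (cycleIdeal K n k) := by
  have h := extDepth_cycle (K := K) hn d hd
  rw [extDepth_iff (by rw [← vIdeal_univ]; exact vIdeal_le)] at h
  obtain ⟨rs, rfl, h1, h2⟩ := h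
  exact le_sSup ⟨rs, h1, h2, rfl⟩

theorem domset (n k : ℕ) (hk : 1 ≤ k) (hn : 2 * k + 2 ≤ n) :
    ∃ W : Finset (Fin n), W.card ≤ (n + 2 * k) / (2 * k + 1) ∧
      (∀ i ∈ W, ∀ j ∈ W, ¬ cE n k i j) ∧ ∀ i ∉ W, ∃ w ∈ W, cE n k w i := by
  set c := (n + 2 * k) / (2 * k + 1) with hc
  have hc1 : c * (2 * k + 1) ≤ n + 2 * k := Nat.div_mul_le_self _ _
  have hc2 : n + 2 * k < (c + 1) * (2 * k + 1) := by
    have := Nat.lt_div_mul_add (a := n + 2 * k) (b := 2 * k + 1) (by omega)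
    rw [← hc] at this
    linarith [add_mul c 1 (2 * k + 1)]
  have hcpos : 2 ≤ c := by
    by_contra h
    have : (c + 1) * (2 * k + 1) ≤ 2 * (2 * k + 1) := Nat.mul_le_mul_right _ (by omega)
    omega
  have hup : n ≤ c * (2 * k + 1) := by nlinarith
  have hlo : c * (k + 1) ≤ n := by nlinarith
  let w : ℕ → ℕ := fun i => i * n / c
  have hw0 : w 0 = 0 := by simp [w]
  have hwc : w c = n := by simp only [w]; rw [Nat.mul_div_cancel_left _ (by omega)]
  have g1 : ∀ i, w i + (k + 1) ≤ w (i + 1) := by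
    intro i
    simp only [w]
    rw [Nat.le_div_iff_mul_le (by omega)]
    have := Nat.div_mul_le_self (i * n) c
    nlinarith
  have g2 : ∀ i, w (i + 1) ≤ w i + (2 * k + 1) := by
    intro i
    simp only [w]
    rw [← Nat.lt_succ_iff, Nat.div_lt_iff_lt_mul (by omega)]
    have := Nat.lt_div_mul_add (a := i * n) (b := c) (by omega)
    simp only [Nat.succ_eq_add_one]
    nlinarith
  have hmono : StrictMono w := strictMono_nat_of_lt_succ fun i => by have := g1 i; omega
  have gap : ∀ i j, i < j → w i + (k + 1) ≤ w j := fun i j h =>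
    (g1 i).trans (hmono.monotone h)
  have hwlt : ∀ i, i < c → w i < n := fun i h => hwc ▸ hmono h
  have hwrap : ∀ j, j < c → w j + (k + 1) ≤ n := fun j h => by
    have := gap j c h
    omega
  classical
  refine ⟨Finset.univ.image (fun i : Fin c => (⟨w i, hwlt i i.2⟩ : Fin n)), ?_, ?_, ?_⟩
  · exact Finset.card_image_le.trans (by simp)
  · intro a ha b hb
    obtain ⟨i, -, rfl⟩ := Finset.mem_image.1 ha
    obtain ⟨j, -, rfl⟩ := Finset.mem_image.1 hb
    simp only [cE]
    have hi := hwrap i i.2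
    have hj := hwrap j j.2
    rcases lt_trichotomy (i : ℕ) j with h | h | h
    · have := gap i j h
      omega
    · rw [h]; omega
    · have := gap j i h
      omega
  · intro x hx
    have hex : ∃ i, (x : ℕ) < w (i + 1) := ⟨c, by
      have := hmono (Nat.lt_succ_self c)
      have := x.2
      simp only [Nat.succ_eq_add_one] at *
      omega⟩
    obtain ⟨i, hi1, hi2⟩ : ∃ i, w i ≤ x ∧ (x : ℕ) < w (i + 1) := by
      classical
      refine ⟨Nat.find hex, ?_, Nat.find_spec hex⟩
      rcases Nat.eq_zero_or_pos (Nat.find hex) with h | h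
      · rw [h, hw0]; omega
      · have := Nat.find_min hex (m := Nat.find hex - 1) (by omega)
        rw [Nat.sub_add_cancel h] at this
        omega
    have hic : i < c := by
      by_contra h
      have := hmono.monotone (not_lt.1 h)
      rw [hwc] at this
      omega
    have hmem : ∀ j (hj : j < c), (⟨w j, hwlt j hj⟩ : Fin n) ∈
        Finset.univ.image (fun i : Fin c => (⟨w i, hwlt i i.2⟩ : Fin n)) := fun j hj =>
      Finset.mem_image.2 ⟨⟨j, hj⟩, Finset.mem_univ _, rfl⟩
    have hne : w i ≠ x := by
      intro h
      apply hx
      have := hmem i hic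
      convert this using 1
      exact Fin.ext h.symm
    have := g2 i
    by_cases hxk : (x : ℕ) ≤ w i + k
    · refine ⟨_, hmem i hic, ?_⟩
      simp only [cE]
      omega
    · by_cases hi' : i + 1 < c
      · refine ⟨_, hmem (i + 1) hi', ?_⟩
        simp only [cE]
        omega
      · have e : i + 1 = c := by omega
        rw [e, hwc] at hi2 this
        refine ⟨_, hmem 0 (by omega), ?_⟩
        simp only [cE, hw0]
        omega

theorem dim_quot_le (K : Type u) [Field K] {n : ℕ} (W : Finset (Fin n)) :
    ringKrullDim (MvPolynomial (Fin n) K ⧸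
      (Ideal.span {m | ∃ i, i ∉ W ∧ m = X i} : Ideal (MvPolynomial (Fin n) K))) ≤ (W.card : ℕ) := by
  set J : Ideal (MvPolynomial (Fin n) K) := Ideal.span {m | ∃ i, i ∉ W ∧ m = X i} with hJ
  let φ : MvPolynomial W K →+* (MvPolynomial (Fin n) K ⧸ J) :=
    (Ideal.Quotient.mk J).comp (rename (Subtype.val : W → Fin n)).toRingHom
  have hφ : Function.Surjective φ := by
    intro a
    obtain ⟨a, rfl⟩ := Ideal.Quotient.mk_surjective a
    induction a using MvPolynomial.induction_on with
    | C a => exact ⟨C a, by simp [φ]⟩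
    | add p q hp hq =>
      obtain ⟨p', hp'⟩ := hp
      obtain ⟨q', hq'⟩ := hq
      exact ⟨p' + q', by rw [map_add, hp', hq', map_add]⟩
    | mul_X p i hp =>
      obtain ⟨p', hp'⟩ := hp
      by_cases hi : i ∈ W
      · exact ⟨p' * X ⟨i, hi⟩, by rw [map_mul, hp', map_mul]; simp [φ]⟩
      · refine ⟨0, ?_⟩
        rw [map_zero, map_mul]
        have : (Ideal.Quotient.mk J) (X i) = 0 :=
          Ideal.Quotient.eq_zero_iff_mem.2 (Ideal.subset_span ⟨i, hi, rfl⟩)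
        rw [this, mul_zero]
  refine (ringKrullDim_le_of_surjective φ hφ).trans ?_
  rw [MvPolynomial.ringKrullDim_of_isNoetherianRing, ringKrullDim_eq_zero_of_field]
  simp

theorem pdepth_le {K : Type u} [Field K] {n k : ℕ} (hk : 1 ≤ k) (hn : 2 * k + 2 ≤ n) :
    pdepth (cycleIdeal K n k) ≤ (((n + 2 * k) / (2 * k + 1) : ℕ) : ℕ∞) := by
  obtain ⟨W, hW, hind, hdom⟩ := domset n k hk hn
  refine sSup_le ?_
  rintro _ ⟨rs, h1, h2, rfl⟩
  classical
  set J : Ideal (MvPolynomial (Fin n) K) := Ideal.span {m | ∃ i, i ∉ W ∧ m = X i} with hJ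
  let P : MvPolynomial (Fin n) K := ∏ w ∈ W, X w
  have hdimle := len_le_dim (mI K n) rs (MvPolynomial (Fin n) K ⧸ cycleIdeal K n k) h1 h2
    (Submodule.Quotient.mk P) (by
      intro s hs
      have hs' : s * P ∈ cycleIdeal K n k := (Submodule.Quotient.mk_eq_zero _).1 hs
      let φ : MvPolynomial (Fin n) K →ₐ[K] MvPolynomial (Fin n) K :=
        aeval (fun i => if i ∈ W then X i else 0)
      have hker : cycleIdeal K n k ≤ RingHom.ker φ := by
        unfold cycleIdeal
        rw [Ideal.span_le]
        rintro m ⟨i, j, hij, hij', rfl⟩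
        change φ _ = 0
        rw [map_mul]
        simp only [φ, aeval_X]
        by_cases hi : i ∈ W
        · by_cases hj : j ∈ W
          · exact absurd (Or.inl ⟨hij, hij'⟩) (hind i hi j hj)
          · simp [hj]
        · simp [hi]
      have h0 : φ (s * P) = 0 := hker hs'
      have hP : φ P ≠ 0 := by
        simp only [P, map_prod]
        rw [Finset.prod_ne_zero_iff]
        intro w hw
        simp [φ, hw]
      rw [map_mul] at h0
      have h3 := (mul_eq_zero.1 h0).resolve_right hP
      rw [mem_mI]
      have h4 : constantCoeff (φ s) = constantCoeff s := by
        have : (constantCoeff.comp φ.toRingHom : MvPolynomial (Fin n) K →+* K) = constantCoeff := by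
          apply MvPolynomial.ringHom_ext
          · intro r; simp [φ]
          · intro i
            simp only [φ, RingHom.comp_apply, AlgHom.toRingHom_eq_coe, RingHom.coe_coe, aeval_X]
            split_ifs <;> simp
        exact congrArg (fun f : MvPolynomial (Fin n) K →+* K => f s) this
      rw [← h4, h3, map_zero])
    J (by
      intro s hs
      refine (Submodule.Quotient.mk_eq_zero _).2 ?_
      change s * P ∈ cycleIdeal K n k
      have hle : J ≤ (cycleIdeal K n k).colon {P} := by
        rw [hJ, Ideal.span_le]
        rintro m ⟨i, hi, rfl⟩
        rw [SetLike.mem_coe, Submodule.mem_colon_singleton, smul_eq_mul]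
        obtain ⟨w, hw, hwi⟩ := hdom i hi
        have hdvd : (X w : MvPolynomial (Fin n) K) ∣ P := Finset.dvd_prod_of_mem _ hw
        obtain ⟨q, hq⟩ := hdvd
        rw [hq, ← mul_assoc]
        refine Ideal.mul_mem_right _ _ ?_
        rw [← vIdeal_univ]
        exact Ideal.subset_span (Or.inr ⟨i, w, cE_symm _ _ _ _ hwi, rfl⟩)
      have := hle hs
      rwa [Submodule.mem_colon_singleton, smul_eq_mul] at this)
  have h5 := hdimle.trans (dim_quot_le K W)
  have h6 : rs.length ≤ W.card := by exact_mod_cast h5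
  exact_mod_cast h6.trans hW


end helpB

theorem stmt15 (K : Type*) [Field K] (n k : ℕ) (hk : 1 ≤ k) (hn : 2 * k + 2 ≤ n) :
    ((n % (2 * k + 1) = 0 ∨ (k + 1 ≤ n % (2 * k + 1) ∧ n % (2 * k + 1) ≤ 2 * k)) →
      pdepth (cycleIdeal K n k) = (((n + 2 * k) / (2 * k + 1) : ℕ) : ℕ∞)) ∧
    (((n + 2 * k) / (2 * k + 1) - 1 : ℕ) : ℕ∞) ≤ pdepth (cycleIdeal K n k) ∧
    pdepth (cycleIdeal K n k) ≤ (((n + 2 * k) / (2 * k + 1) : ℕ) : ℕ∞) := by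
  have hup := pdepth_le (K := K) hk hn
  have hdm := Nat.div_add_mod n (2 * k + 1)
  have hlt := Nat.mod_lt n (y := 2 * k + 1) (by omega)
  set q := n / (2 * k + 1) with hq
  set r := n % (2 * k + 1) with hr
  have hc : r = 0 ∧ (n + 2 * k) / (2 * k + 1) = q ∨
      0 < r ∧ (n + 2 * k) / (2 * k + 1) = q + 1 := by
    rcases Nat.eq_zero_or_pos r with h | h
    · left
      refine ⟨h, ?_⟩
      refine Nat.div_eq_of_lt_le ?_ ?_ <;> nlinarith
    · right
      refine ⟨h, ?_⟩
      refine Nat.div_eq_of_lt_le ?_ ?_ <;> nlinarith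
  refine ⟨fun h => le_antisymm hup (le_pdepth hn _ ?_), le_pdepth hn _ ?_, hup⟩
  · rcases hc with ⟨h0, h1⟩ | ⟨h0, h1⟩
    · rw [h1]; nlinarith
    · rw [h1]
      have : k + 1 ≤ r := by omega
      nlinarith
  · rcases hc with ⟨h0, h1⟩ | ⟨h0, h1⟩
    · rw [h1]
      have : (q - 1) * (2 * k + 1) ≤ q * (2 * k + 1) := Nat.mul_le_mul_right _ (Nat.sub_le _ _)
      nlinarith
    · rw [h1, Nat.add_sub_cancel]
      nlinarith
end
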